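/- Let G be a finitely generated group, E an admissible family of subgroups of G, and T a minimal E-tree. If Y is a cylinder of T with ∂Y non-empty, then Y is the convex hull of ∂Y, and |∂Y| ≥ 2. -/

import Mathlib

open scoped Pointwise symmDiff

namespace SSRN

section Group
variable {G : Type*} [Group G]

/-- A subset of `G` is `H`-finite if it is contained in finitely many orbits of the
action of `H` on `G` by left multiplication. -/
def HFin (H : Subgroup G) (X : Set G) : Prop :=
  ∃ F : Finset G, X ⊆ ⋃ f ∈ F, (· * f) '' (H : Set G)

/-- Two subsets of `G` are `H`-equivalent if their symmetric difference is `H`-finite. -/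
def AIEquiv (H : Subgroup G) (X Y : Set G) : Prop := HFin H (X ∆ Y)

/-- `X` is an `H`-almost invariant subset of `G`. -/
def IsAI (H : Subgroup G) (X : Set G) : Prop :=
  (∀ h ∈ H, (h * ·) '' X = X) ∧ ∀ s : G, HFin H (((· * s) '' X) ∆ X)

/-- `X` is a non-trivial `H`-almost invariant subset of `G`. -/
def NontrivAI (H : Subgroup G) (X : Set G) : Prop :=
  IsAI H X ∧ ¬ HFin H X ∧ ¬ HFin H Xᶜ

/-- The `H`-almost invariant set `X` crosses `Y`: none of the four corners is `H`-finite. -/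
def Crosses (H : Subgroup G) (X Y : Set G) : Prop :=
  ¬ HFin H (X ∩ Y) ∧ ¬ HFin H (X ∩ Yᶜ) ∧ ¬ HFin H (Xᶜ ∩ Y) ∧ ¬ HFin H (Xᶜ ∩ Yᶜ)

/-- Crossing of (non-trivial) almost invariant sets, quantifying over the groups over
which they are almost invariant. -/
def CrossesAny (X X' : Set G) : Prop :=
  ∃ H K : Subgroup G, NontrivAI H X ∧ NontrivAI K X' ∧ Crosses H X X'

/-- `X` and `X'` determine the same unordered pair `{[X], [X*]}` of equivalence classes. -/
def SamePair (X X' : Set G) : Prop :=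
  ∃ H : Subgroup G, NontrivAI H X ∧ (HFin H (X ∆ X') ∨ HFin H (X ∆ X'ᶜ))

/-- An admissible family of subgroups: conjugacy invariant, closed under commensurability,
and no member contains another with infinite index. -/
def Admissible (E : Set (Subgroup G)) : Prop :=
  (∀ H ∈ E, ∀ g : G, (MulAut.conj g • H) ∈ E) ∧
  (∀ H ∈ E, ∀ K : Subgroup G, Subgroup.Commensurable K H → K ∈ E) ∧
  (∀ A ∈ E, ∀ B ∈ E, A ≤ B → A.relIndex B ≠ 0)

end Group

section Tree

variable {V : Type*}

/-- The stabilizer of an edge `e : Sym2 V` under the action of `G`. -/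
def edgeStab (G : Type*) [Group G] [MulAction G V] (e : Sym2 V) : Subgroup G where
  carrier := {g | Sym2.map (g • ·) e = e}
  one_mem' := by
    show Sym2.map ((1 : G) • ·) e = e
    have : ((1 : G) • · : V → V) = id := by funext v; simp
    rw [this, Sym2.map_id]; rfl
  mul_mem' := by
    intro a b ha hb
    show Sym2.map ((a * b) • ·) e = e
    have : ((a * b) • · : V → V) = (a • ·) ∘ (b • ·) := by funext v; simp [mul_smul]
    rw [this, ← Sym2.map_map, hb, ha]
  inv_mem' := by
    intro a ha
    show Sym2.map (a⁻¹ • ·) e = e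
    conv_lhs => rw [← ha]
    rw [Sym2.map_map]
    have : ((a⁻¹ • ·) ∘ (a • ·) : V → V) = id := by funext v; simp
    rw [this, Sym2.map_id]; rfl

variable (T : SimpleGraph V)

/-- `G` acts on the graph `T` by graph automorphisms. -/
def ActsOn (G : Type*) [Group G] [MulAction G V] : Prop :=
  ∀ (g : G) (u v : V), T.Adj u v → T.Adj (g • u) (g • v)

/-- The action of `G` on `T` is without inversions. -/
def NoInversions (G : Type*) [Group G] [MulAction G V] : Prop :=
  ∀ (g : G) (u v : V), T.Adj u v → ¬ (g • u = v ∧ g • v = u)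

/-- `w` lies between `u` and `v`: it is on every path from `u` to `v`. -/
def Btw (u w v : V) : Prop := ∀ p : T.Walk u v, p.IsPath → w ∈ p.support

/-- The action of `G` on the tree `T` is minimal: every nonempty invariant subtree
(convex invariant set of vertices) is the whole vertex set. -/
def MinimalAction (G : Type*) [Group G] [MulAction G V] : Prop :=
  ∀ A : Set V, A.Nonempty → (∀ (g : G), ∀ a ∈ A, g • a ∈ A) →
    (∀ u ∈ A, ∀ v ∈ A, ∀ w : V, Btw T u w v → w ∈ A) → A = Set.univ

/-- The action of `G` is non-trivial: there is no global fixed vertex. -/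
def NontrivialAction (G : Type*) [Group G] [MulAction G V] : Prop :=
  ¬ ∃ v : V, ∀ g : G, g • v = v

/-- `T` is an `E`-tree: all edge stabilizers belong to `E`. -/
def IsETree (G : Type*) [Group G] [MulAction G V] (E : Set (Subgroup G)) : Prop :=
  ∀ e ∈ T.edgeSet, edgeStab G e ∈ E

/-- There are finitely many `G`-orbits of edges. -/
def FinEdgeOrbits (G : Type*) [Group G] [MulAction G V] : Prop :=
  ∃ F : Finset (Sym2 V), ∀ e ∈ T.edgeSet, ∃ e₀ ∈ F, ∃ g : G, Sym2.map (g • ·) e₀ = e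

/-- A cylinder of `T`: an equivalence class of edges for commensurability of stabilizers. -/
def IsCylinder (G : Type*) [Group G] [MulAction G V] (Y : Set (Sym2 V)) : Prop :=
  Y.Nonempty ∧ Y ⊆ T.edgeSet ∧
    ∀ e ∈ Y, ∀ e' ∈ T.edgeSet,
      (e' ∈ Y ↔ Subgroup.Commensurable (edgeStab G e) (edgeStab G (V := V) e'))

/-- The set of vertices of a set of edges (e.g. of a cylinder). -/
def cylVerts (Y : Set (Sym2 V)) : Set V := {v | ∃ e ∈ Y, v ∈ e}

/-- The boundary of a cylinder: its vertices lying in another cylinder,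
i.e. incident to an edge outside the cylinder. -/
def cylBoundary (Y : Set (Sym2 V)) : Set V :=
  {v | v ∈ cylVerts Y ∧ ∃ e ∈ T.edgeSet, v ∈ e ∧ e ∉ Y}

/-- `H` belongs to the commensurability class associated to the cylinder `Y`. -/
def InClassOf (G : Type*) [Group G] [MulAction G V] (Y : Set (Sym2 V)) (H : Subgroup G) : Prop :=
  ∃ e ∈ Y, Subgroup.Commensurable H (edgeStab G e)

/-- The coboundary of a set of vertices: edges with exactly one endpoint in it. -/
def cobdry (S : Set V) : Set (Sym2 V) :=
  {e | e ∈ T.edgeSet ∧ ∃ u v : V, e = s(u, v) ∧ u ∈ S ∧ v ∉ S}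

/-- `S` is a special forest based on the cylinder `Y`. -/
def IsSpecialForest (S : Set V) (Y : Set (Sym2 V)) : Prop :=
  (cobdry T S).Finite ∧ cobdry T S ⊆ Y

/-- A set of vertices is non-trivial if it is neither finite nor cofinite. -/
def NontrivForest (S : Set V) : Prop := ¬ S.Finite ∧ ¬ (Sᶜ : Set V).Finite

/-- The almost invariant set associated to a set of vertices. -/
def XS (G : Type*) [Group G] [MulAction G V] (v₀ : V) (S : Set V) : Set G :=
  {g : G | g • v₀ ∈ S}

/-- The component `T_e` of `T` minus the open edge `e = s(u,v)` containing the terminal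
vertex `v`. -/
def halfTree (u v : V) : Set V :=
  {w | ∃ p : T.Walk v w, p.IsPath ∧ s(u, v) ∉ p.edges}

/-- The almost invariant set `Z_e` dual to the oriented edge `(u, v)`. -/
def Ze (G : Type*) [Group G] [MulAction G V] (v₀ u v : V) : Set G :=
  XS G v₀ (halfTree T u v)

/-- `v` has finitely many incident edges in `Y`. -/
def FiniteValenceIn (Y : Set (Sym2 V)) (v : V) : Prop := {e | e ∈ Y ∧ v ∈ e}.Finite

/-- The peripheral special forest `S_{v,Y}`: the component of `v` in `T` minus the open
edges of `Y` incident to `v`. -/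
def periForest (Y : Set (Sym2 V)) (v : V) : Set V :=
  {w | ∃ p : T.Walk v w, p.IsPath ∧ ∀ e ∈ Y, v ∈ e → e ∉ p.edges}

/-- The peripheral almost invariant set `X_{v,Y}`. -/
def XvY (G : Type*) [Group G] [MulAction G V] (v₀ : V) (Y : Set (Sym2 V)) (v : V) : Set G :=
  XS G v₀ (periForest T Y v)

/-- A peripheral special forest: one equivalent to some `S_{v,Y}`. -/
def PeripheralForest (G : Type*) [Group G] [MulAction G V] (S : Set V) : Prop :=
  ∃ (Y : Set (Sym2 V)) (v : V), IsCylinder T G Y ∧ v ∈ cylBoundary T Y ∧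
    FiniteValenceIn Y v ∧ (S ∆ periForest T Y v).Finite

/-- The Boolean algebra `B_C(T)` of (representatives of) almost invariant sets based on the
cylinder `Y`: the smallest family containing the sets `Z_e`, `e ∈ Y`, closed under
complement, intersection and `H`-equivalence. -/
def BCT {G : Type*} [Group G] [MulAction G V] (v₀ : V) (Y : Set (Sym2 V)) (H : Subgroup G) :
    Set (Set G) :=
  ⋂₀ {F : Set (Set G) |
    (∀ u v : V, T.Adj u v → s(u, v) ∈ Y → Ze T G v₀ u v ∈ F) ∧
    (∀ X ∈ F, Xᶜ ∈ F) ∧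
    (∀ X ∈ F, ∀ X' ∈ F, X ∩ X' ∈ F) ∧
    (∀ X ∈ F, ∀ X' : Set G, HFin H (X ∆ X') → X' ∈ F)}

/-- The set `B(T)` of (representatives of) almost invariant sets based on `T`. -/
def BT (G : Type*) [Group G] [MulAction G V] (v₀ : V) : Set (Set G) :=
  {X | ∃ Y : Set (Sym2 V), IsCylinder T G Y ∧ ∃ e ∈ Y, X ∈ BCT T v₀ Y (edgeStab G e)}

/-- Elements of `B(T)` that are non-trivial almost invariant sets. -/
def NontrivB (G : Type*) [Group G] [MulAction G V] (v₀ : V) : Set (Set G) :=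
  {X | X ∈ BT T G v₀ ∧ ∃ H : Subgroup G, NontrivAI H X}

/-- One step of the relation generating cross-connected components. -/
def ccStep (G : Type*) [Group G] [MulAction G V] (v₀ : V) (X X' : Set G) : Prop :=
  X ∈ NontrivB T G v₀ ∧ X' ∈ NontrivB T G v₀ ∧ (CrossesAny X X' ∨ SamePair X X')

/-- The equivalence relation generated by crossing (and identification of equivalent sets
and complements) on `B(T)`. -/
def ccRel (G : Type*) [Group G] [MulAction G V] (v₀ : V) : Set G → Set G → Prop :=
  Relation.EqvGen (ccStep T G v₀)

/-- The cross-connected component of (the pair determined by) `X`. -/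
def ccOf (G : Type*) [Group G] [MulAction G V] (v₀ : V) (X : Set G) : Set (Set G) :=
  {X' | ccRel T G v₀ X X'}

/-- `C` is a cross-connected component of `B(T)`. -/
def IsCCC (G : Type*) [Group G] [MulAction G V] (v₀ : V) (C : Set (Set G)) : Prop :=
  ∃ X ∈ NontrivB T G v₀, C = ccOf T G v₀ X

/-- A cross-connected component is based on the cylinder `Y` if its members are almost
invariant over subgroups in the commensurability class of `Y`. -/
def CCCBasedOn (G : Type*) [Group G] [MulAction G V] (Y : Set (Sym2 V)) (C : Set (Set G)) :
    Prop :=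
  ∃ X ∈ C, ∃ H : Subgroup G, InClassOf G Y H ∧ NontrivAI H X

/-- A peripheral cross-connected component. -/
def PeripheralCCC (G : Type*) [Group G] [MulAction G V] (v₀ : V) (C : Set (Set G)) : Prop :=
  ∃ (Y : Set (Sym2 V)) (v : V), IsCylinder T G Y ∧ v ∈ cylBoundary T Y ∧
    FiniteValenceIn Y v ∧ XvY T G v₀ Y v ∈ C

/-- Betweenness of (distinct) cross-connected components. -/
def CCCBetween {G : Type*} [Group G] (C₁ C₂ C₃ : Set (Set G)) : Prop :=
  C₁ ≠ C₂ ∧ C₂ ≠ C₃ ∧ C₁ ≠ C₃ ∧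
    ∃ X₁ ∈ C₁, ∃ X₂ ∈ C₂, ∃ X₃ ∈ C₃, X₁ ⊆ X₂ ∧ X₂ ⊆ X₃

/-- A star of cross-connected components. -/
def IsStar (G : Type*) [Group G] [MulAction G V] (v₀ : V) (St : Set (Set (Set G))) : Prop :=
  (∀ C ∈ St, IsCCC T G v₀ C) ∧ St.Nontrivial ∧
  (∀ C ∈ St, ∀ C' ∈ St, ∀ C'' : Set (Set G), IsCCC T G v₀ C'' → ¬ CCCBetween C C'' C') ∧
  (∀ St' : Set (Set (Set G)), St ⊆ St' → (∀ C ∈ St', IsCCC T G v₀ C) →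
    (∀ C ∈ St', ∀ C' ∈ St', ∀ C'' : Set (Set G), IsCCC T G v₀ C'' → ¬ CCCBetween C C'' C') →
    St' = St)

/-- The regular neighbourhood `RN(B(T))`: the bipartite graph on cross-connected
components and stars. -/
def RNGraph (G : Type*) [Group G] [MulAction G V] (v₀ : V) :
    SimpleGraph ({C : Set (Set G) // IsCCC T G v₀ C} ⊕
      {St : Set (Set (Set G)) // IsStar T G v₀ St}) where
  Adj x y :=
    match x, y with
    | Sum.inl C, Sum.inr St => C.1 ∈ St.1
    | Sum.inr St, Sum.inl C => C.1 ∈ St.1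
    | _, _ => False
  symm := ⟨by rintro (C | St) (C' | St') h <;> exact h⟩
  loopless := ⟨by rintro (C | St) h <;> exact h⟩

/-- Vertices of `T` lying in at least two cylinders. -/
def TcV0 (G : Type*) [Group G] [MulAction G V] : Set V :=
  {v | ∃ Y Y' : Set (Sym2 V), IsCylinder T G Y ∧ IsCylinder T G Y' ∧ Y ≠ Y' ∧
    v ∈ cylVerts Y ∧ v ∈ cylVerts Y'}

/-- The tree of cylinders `T_c` of `T`, as a bipartite graph. -/
def TcGraph (G : Type*) [Group G] [MulAction G V] :
    SimpleGraph ({v : V // v ∈ TcV0 T G} ⊕ {Y : Set (Sym2 V) // IsCylinder T G Y}) where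
  Adj x y :=
    match x, y with
    | Sum.inl v, Sum.inr Y => v.1 ∈ cylVerts Y.1
    | Sum.inr Y, Sum.inl v => v.1 ∈ cylVerts Y.1
    | _, _ => False
  symm := ⟨by rintro (v | Y) (v' | Y') h <;> exact h⟩
  loopless := ⟨by rintro (v | Y) h <;> exact h⟩


/-- `T` dominates `T'`: there is a `G`-equivariant map. -/
def Dominates (G : Type*) [Group G] {V V' : Type*} [MulAction G V] [MulAction G V']
    (T : SimpleGraph V) (T' : SimpleGraph V') : Prop :=
  ∃ f : V → V', ∀ (g : G) (x : V), f (g • x) = g • f x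

end Tree

section Subdiv

variable {α β : Type*}

/-- `S` is a subdivision of `Γ` via the vertex embedding `f`. -/
def SubdivVia (f : α → β) (S : SimpleGraph β) (Γ : SimpleGraph α) : Prop :=
  Function.Injective f ∧
  (∀ b : β, b ∉ Set.range f → ∃ x y : β, x ≠ y ∧ S.neighborSet b = {x, y}) ∧
  (∀ u : α, Nonempty (Γ.neighborSet u ≃ S.neighborSet (f u))) ∧
  (∀ u v : α, Γ.Adj u v ↔ ∃ p : S.Walk (f u) (f v), p.IsPath ∧ 1 ≤ p.length ∧
      ∀ w ∈ p.support, w ∈ Set.range f → w = f u ∨ w = f v) ∧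
  (∀ e ∈ S.edgeSet, ∃ (u v : α) (p : S.Walk (f u) (f v)), Γ.Adj u v ∧ p.IsPath ∧
      (∀ w ∈ p.support, w ∈ Set.range f → w = f u ∨ w = f v) ∧ e ∈ p.edges)

/-- `S` is (isomorphic to) a subdivision of `Γ`. -/
def IsSubdivision (S : SimpleGraph β) (Γ : SimpleGraph α) : Prop :=
  ∃ f : α → β, SubdivVia f S Γ

end Subdiv

end SSRN

namespace SSRN

/-- The automorphism of `T` given by `g`, as a graph homomorphism. -/
def actHom {G V : Type*} [Group G] [MulAction G V] (T : SimpleGraph V) (hact : ActsOn T G)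
    (g : G) : T →g T where
  toFun := fun v => g • v
  map_rel' := fun {u v} h => hact g u v h

/-- The half tree on the side of `v` (graph with the edge `uv` removed). -/
def side {V : Type*} (T : SimpleGraph V) (u v : V) : Set V :=
  {w | (T.deleteEdges {s(u, v)}).Reachable v w}

theorem side_cross {V : Type*} (T : SimpleGraph V) {u v a b : V}
    (ha : a ∉ side T u v) (hb : b ∈ side T u v) (p : T.Walk a b) : s(u, v) ∈ p.edges := by
  by_contra h
  apply ha
  have h1 : (T.deleteEdges {s(u, v)}).Reachable a b :=
    ⟨p.toDeleteEdge _ h⟩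
  exact SimpleGraph.Reachable.trans hb h1.symm

theorem side_compl_convex {V : Type*} (T : SimpleGraph V) {u v a b w : V}
    (ha : a ∉ side T u v) (hb : b ∉ side T u v) (p : T.Walk a b) (hp : p.IsPath)
    (hw : w ∈ p.support) : w ∉ side T u v := by
  classical
  intro hws
  have h1 := side_cross T ha hws (p.takeUntil w hw)
  have h2 := side_cross T hb hws (p.dropUntil w hw).reverse
  rw [SimpleGraph.Walk.edges_reverse, List.mem_reverse] at h2
  have hn := hp.isTrail.edges_nodup
  rw [← p.take_spec hw, SimpleGraph.Walk.edges_append] at hn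
  exact (List.disjoint_of_nodup_append hn) h1 h2

theorem bridge {V : Type*} {T : SimpleGraph V} (hT : T.IsTree) {u v : V} (h : T.Adj u v) :
    u ∉ side T u v := by
  intro hr
  have := SimpleGraph.isAcyclic_iff_forall_adj_isBridge.1 hT.isAcyclic h
  rw [SimpleGraph.isBridge_iff] at this
  exact this (SimpleGraph.Reachable.symm hr)

theorem orbit_meets {G V : Type*} [Group G] [MulAction G V]
    (T : SimpleGraph V) (hT : T.IsTree) (hact : ActsOn T G)
    (hmin : MinimalAction T G) (u v x : V) : ∃ g : G, g • x ∈ side T u v := by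
  by_contra hcon
  push Not at hcon
  have hA := hmin {w | ∀ g : G, g • w ∉ side T u v} ⟨x, hcon⟩
    (fun g a ha k => by rw [← mul_smul]; exact ha _)
    (fun a ha b hb w hw g => by
      obtain ⟨p, hp⟩ := hT.connected.exists_isPath a b
      have hw' := hw p hp
      refine side_compl_convex T (ha g) (hb g) (p.map (actHom T hact g))
        (SimpleGraph.Walk.map_isPath_of_injective (MulAction.injective g) hp) ?_
      exact (SimpleGraph.Walk.support_map (actHom T hact g) p).symm ▸
        List.mem_map.2 ⟨w, hw', rfl⟩)
  have hv : v ∈ {w | ∀ g : G, g • w ∉ side T u v} := by rw [hA]; trivial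
  have := hv 1
  rw [one_smul] at this
  exact this (SimpleGraph.Reachable.refl _)

theorem mem_edgeStab {G V : Type*} [Group G] [MulAction G V] (e : Sym2 V) (g : G) :
    g ∈ edgeStab G e ↔ Sym2.map (g • ·) e = e := Iff.rfl

theorem edgeStab_map {G V : Type*} [Group G] [MulAction G V] (e : Sym2 V) (g : G) :
    edgeStab G (Sym2.map (g • ·) e) = MulAut.conj g • edgeStab G e := by
  ext h
  rw [Subgroup.mem_pointwise_smul_iff_inv_smul_mem, mem_edgeStab, mem_edgeStab]
  induction e with | _ a b =>
  simp only [Sym2.map_mk, MulAut.smul_def, ← map_inv, MulAut.conj_apply, inv_inv, mul_smul]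
  have key : ∀ c d : V, s(g⁻¹ • c, g⁻¹ • d) = Sym2.map (g⁻¹ • ·) s(c, d) := fun _ _ => rfl
  have hinj : Function.Injective (Sym2.map (g⁻¹ • · : V → V)) :=
    Sym2.map.injective (MulAction.injective _)
  constructor
  · intro H
    rw [key, H]; simp
  · intro H
    apply hinj
    rw [← key, H]; simp

theorem stab_fixes {G V : Type*} [Group G] [MulAction G V]
    {T : SimpleGraph V} (hinv : NoInversions T G) {e : Sym2 V} (he : e ∈ T.edgeSet)
    {v : V} (hv : v ∈ e) {g : G} (hg : g ∈ edgeStab G e) : g • v = v := by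
  obtain ⟨w, rfl⟩ := hv
  rw [mem_edgeStab, Sym2.map_mk, Sym2.eq_iff] at hg
  rcases hg with h | h
  · exact h.1
  · exact absurd h (hinv g v w he)

theorem fixes_path {G V : Type*} [Group G] [MulAction G V]
    {T : SimpleGraph V} (hT : T.IsTree) (hact : ActsOn T G) {u x : V} (p : T.Walk u x)
    (hp : p.IsPath) (g : G) (hu' : g • u = u) (hx' : g • x = x) :
    ∀ w ∈ p.support, g • w = w := by
  have hu : actHom T hact g u = u := hu'
  have hx : actHom T hact g x = x := hx'
  have hq : ((p.map (actHom T hact g)).copy hu hx).IsPath := by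
    rw [SimpleGraph.Walk.isPath_copy]
    exact SimpleGraph.Walk.map_isPath_of_injective (MulAction.injective g) hp
  have := hT.isAcyclic.path_unique ⟨_, hq⟩ ⟨p, hp⟩
  have h2 := congrArg (fun q : T.Path u x => q.1.support) this
  simp only [SimpleGraph.Walk.support_copy, SimpleGraph.Walk.support_map] at h2
  have h3 : p.support.map (actHom T hact g) = p.support.map id := by rw [h2, List.map_id]
  exact fun w hw => List.map_inj_left.1 h3 w hw

theorem comm_conj {G : Type*} [Group G] (g : G) {H K : Subgroup G}
    (h : Subgroup.Commensurable (MulAut.conj g • H) (MulAut.conj g • K)) :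
    Subgroup.Commensurable H K := by
  obtain ⟨h1, h2⟩ := h
  rw [Subgroup.relIndex_pointwise_smul] at h1 h2
  exact ⟨h1, h2⟩

theorem boundary_side {G V : Type*} [Group G] [MulAction G V]
    (T : SimpleGraph V) (hT : T.IsTree) (hact : ActsOn T G)
    (hmin : MinimalAction T G)
    (Y : Set (Sym2 V)) (hY : IsCylinder T G Y)
    (hbd : (cylBoundary T Y).Nonempty) {u v : V} (huv : s(u, v) ∈ Y) :
    ∃ b ∈ cylBoundary T Y, b ∈ side T u v := by
  by_contra hcon
  push Not at hcon
  have hin : ∀ w ∈ side T u v, w ∈ cylVerts Y → ∀ e ∈ T.edgeSet, w ∈ e → e ∈ Y := by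
    intro w hw hwY e he hwe
    by_contra hne
    exact hcon w ⟨hwY, e, he, hwe, hne⟩ hw
  have hall : ∀ w ∈ side T u v, w ∈ cylVerts Y := by
    have haux : ∀ (a w : V) (p : (T.deleteEdges {s(u, v)}).Walk a w), a ∈ side T u v →
        a ∈ cylVerts Y → w ∈ cylVerts Y := by
      intro a w p
      induction p with
      | nil => exact fun _ h => h
      | @cons a b c hab q ih =>
        intro ha haY
        have hadj : T.Adj a b := (T.deleteEdges_le _) hab
        refine ih (SimpleGraph.Reachable.trans ha hab.reachable) ⟨s(a, b), ?_, Sym2.mem_mk_right _ _⟩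
        exact hin a ha haY _ hadj (Sym2.mem_mk_left _ _)
    rintro w ⟨p⟩
    exact haux v w p (SimpleGraph.Reachable.refl _) ⟨_, huv, Sym2.mem_mk_right _ _⟩
  obtain ⟨x, ⟨f, hf, hxf⟩, f', hf', hxf', hnf'⟩ := hbd
  obtain ⟨g, hg⟩ := orbit_meets T hT hact hmin u v x
  have hmap : ∀ e ∈ T.edgeSet, x ∈ e → Sym2.map (g • ·) e ∈ Y := by
    intro e he hxe
    obtain ⟨y, rfl⟩ := hxe
    exact hin _ hg (hall _ hg) _ (hact g x y he) (Sym2.mem_mk_left _ _)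
  have h1 := hmap f (hY.2.1 hf) hxf
  have h2 := hmap f' hf' hxf'
  have h3 := (hY.2.2 _ h1 _ (hY.2.1 h2)).1 h2
  rw [edgeStab_map, edgeStab_map] at h3
  exact hnf' ((hY.2.2 f hf f' hf').2 (comm_conj g h3))

/-- A cylinder with non-empty boundary is the convex hull of its boundary,
and its boundary has at least two points. -/
theorem stmt_13 {G V : Type*} [Group G] [MulAction G V]
    (hGfg : Group.FG G)
    (T : SimpleGraph V) (hT : T.IsTree) (hact : ActsOn T G) (hinv : NoInversions T G)
    (E : Set (Subgroup G)) (hE : Admissible E) (hET : IsETree T G E)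
    (hmin : MinimalAction T G)
    (Y : Set (Sym2 V)) (hY : IsCylinder T G Y)
    (hbd : (cylBoundary T Y).Nonempty) :
    cylVerts Y = {w : V | ∃ u ∈ cylBoundary T Y, ∃ x ∈ cylBoundary T Y, Btw T u w x} ∧
      (cylBoundary T Y).Nontrivial := by
  constructor
  · ext w
    constructor
    · rintro ⟨e, he, v, rfl⟩
      obtain ⟨b, hb, hbs⟩ := boundary_side T hT hact hmin Y hY hbd he
      obtain ⟨c, hc, hcs⟩ := boundary_side T hT hact hmin Y hY hbd
        (show s(v, w) ∈ Y by rwa [Sym2.eq_swap])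
      refine ⟨c, hc, b, hb, fun p _ => ?_⟩
      have hcn : c ∉ side T w v := by
        intro h
        have hcs' : (T.deleteEdges {s(w, v)}).Reachable w c := by
          rw [Sym2.eq_swap]; exact hcs
        exact bridge hT (hY.2.1 he) (SimpleGraph.Reachable.trans h hcs'.symm)
      exact p.fst_mem_support_of_mem_edges (side_cross T hcn hbs p)
    · rintro ⟨u, ⟨⟨e, he, hue⟩, -⟩, x, ⟨⟨f, hf, hxf⟩, -⟩, hw⟩
      obtain ⟨p, hp⟩ := hT.connected.exists_isPath u x
      have hwp := hw p hp
      by_cases hnil : p.Nil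
      · have hwu : w = u := by
          rw [SimpleGraph.Walk.nil_iff_support_eq] at hnil
          rw [hnil] at hwp
          simpa using hwp
        exact ⟨e, he, hwu ▸ hue⟩
      · obtain ⟨d, hd, hwd⟩ := (SimpleGraph.Walk.mem_support_iff_exists_mem_edges_of_not_nil hnil).1 hwp
        have hdT := p.edges_subset_edgeSet hd
        refine ⟨d, ?_, hwd⟩
        have heT := hY.2.1 he
        have hfT := hY.2.1 hf
        have hef := (hY.2.2 e he f hfT).1 hf
        have hle : edgeStab G e ⊓ edgeStab G f ≤ edgeStab G d := by
          rintro g ⟨hge, hgf⟩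
          have hfix := fixes_path hT hact p hp g (stab_fixes hinv heT hue hge)
            (stab_fixes hinv hfT hxf hgf)
          rw [mem_edgeStab]
          induction d with | _ a b =>
          rw [Sym2.map_mk, hfix a (p.fst_mem_support_of_mem_edges hd),
            hfix b (p.snd_mem_support_of_mem_edges hd)]
        have hCe : Subgroup.Commensurable (edgeStab G e ⊓ edgeStab G f) (edgeStab G e) := by
          refine ⟨?_, ?_⟩
          · rw [Subgroup.inf_relIndex_left]; exact hef.2
          · rw [Subgroup.relIndex_eq_one.2 inf_le_left]; exact one_ne_zero
        have hCE := hE.2.1 _ (hET e heT) _ hCe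
        have hCd : Subgroup.Commensurable (edgeStab G e ⊓ edgeStab G f) (edgeStab G d) :=
          ⟨hE.2.2 _ hCE _ (hET d hdT) hle, by
            rw [Subgroup.relIndex_eq_one.2 hle]; exact one_ne_zero⟩
        exact (hY.2.2 e he d hdT).2 (hCe.symm.trans hCd)
  · obtain ⟨e, he⟩ := hY.1
    induction e with | _ w v =>
    obtain ⟨b, hb, hbs⟩ := boundary_side T hT hact hmin Y hY hbd he
    obtain ⟨c, hc, hcs⟩ := boundary_side T hT hact hmin Y hY hbd
      (show s(v, w) ∈ Y by rwa [Sym2.eq_swap])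
    refine ⟨b, hb, c, hc, ?_⟩
    rintro rfl
    have hcs' : (T.deleteEdges {s(w, v)}).Reachable w b := by
      rw [Sym2.eq_swap]; exact hcs
    exact bridge hT (hY.2.1 he) (SimpleGraph.Reachable.trans hbs hcs'.symm)

end SSRN
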